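/- arXiv:math/0409001 — 3 statements merged into one kernel-verified Lean document; each statement's English description precedes it below -/
import Mathlib

section
/- Let (X,μ) be a probability space, T : X → X a measure-preserving transformation, (a_n)_{n≥1} an arbitrary sequence of integers, and f ∈ L^1(μ). Then lim_{N→∞} (1/Φ(N))·Σ_{n=1}^{N} f(T^{a_n} x) = 0 for μ-almost every x ∈ X. -/
open MeasureTheory Filter

/-- Iterated natural logarithm: `logIter j t = log^{(j)}(t)`. -/
noncomputable def logIter : ℕ → ℝ → ℝ
  | 0, t => t
  | (j + 1), t => Real.log (logIter j t)

/-- The number of iterates of `log` (starting with `t` itself) that exceed `1`: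
the least `j` with `log^{(j)}(t) ≤ 1`. -/
noncomputable def iterCount (t : ℝ) : ℕ := by
  classical exact if h : ∃ j, logIter j t ≤ 1 then Nat.find h else 0

/-- `Φ(t) = t · log t · log log t ⋯`, the product of `t` and all iterated logarithms
of `t` that are defined and exceed `1`. -/
noncomputable def Phi (t : ℝ) : ℝ :=
  ∏ j ∈ Finset.range (iterCount t), logIter j t

theorem logIter_succ' (j : ℕ) (t : ℝ) : logIter (j + 1) t = logIter j (Real.log t) := by
  induction j with
  | zero => rfl
  | succ j ih =>
    change Real.log (logIter (j + 1) t) = Real.log (logIter j (Real.log t))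
    rw [ih]

/-- Every real number falls to at most `1` after finitely many applications of `log`, so a property
can be proved by descending along `log`. -/
theorem log_induction {P : ℝ → Prop} (base : ∀ t ≤ 1, P t)
    (step : ∀ t, 1 < t → P (Real.log t) → P t) (t : ℝ) : P t := by
  obtain ⟨n, hn⟩ := exists_nat_ge t
  induction n generalizing t with
  | zero => exact base t (by push_cast at hn; linarith)
  | succ n ih =>
    rcases le_or_gt t 1 with h | h
    · exact base t h
    · refine step t h (ih _ ?_)
      have := Real.log_le_sub_one_of_pos (zero_lt_one.trans h)
      push_cast at hn
      linarith

theorem exists_logIter_le_one (t : ℝ) : ∃ j, logIter j t ≤ 1 := by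
  induction t using log_induction with
  | base t h => exact ⟨0, h⟩
  | step t _ ih =>
    obtain ⟨j, hj⟩ := ih
    exact ⟨j + 1, by rwa [logIter_succ']⟩

theorem iterCount_of_le_one {t : ℝ} (h : t ≤ 1) : iterCount t = 0 := by
  classical
  rw [iterCount, dif_pos (exists_logIter_le_one t)]
  exact (Nat.find_eq_zero _).2 h

theorem iterCount_of_one_lt {t : ℝ} (h : 1 < t) :
    iterCount t = iterCount (Real.log t) + 1 := by
  classical
  rw [iterCount, iterCount, dif_pos (exists_logIter_le_one t),
    dif_pos (exists_logIter_le_one (Real.log t))]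
  have h' : ∃ j, logIter (j + 1) t ≤ 1 := by
    simpa only [logIter_succ'] using exists_logIter_le_one (Real.log t)
  rw [Nat.find_comp_succ (exists_logIter_le_one t) h' (not_le.2 h)]
  simp only [logIter_succ']

theorem Phi_of_le_one {t : ℝ} (h : t ≤ 1) : Phi t = 1 := by
  simp [Phi, iterCount_of_le_one h]

theorem Phi_eq_mul_Phi_log {t : ℝ} (h : 1 ≤ t) : Phi t = t * Phi (Real.log t) := by
  rcases h.eq_or_lt with rfl | h
  · simp [Phi_of_le_one]
  · rw [Phi, iterCount_of_one_lt h, Finset.prod_range_succ', Phi, mul_comm]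
    simp only [logIter_succ']
    rfl

theorem one_le_Phi (t : ℝ) : 1 ≤ Phi t := by
  induction t using log_induction with
  | base t h => exact (Phi_of_le_one h).ge
  | step t h ih =>
    rw [Phi_eq_mul_Phi_log h.le]
    nlinarith

theorem Phi_pos (t : ℝ) : 0 < Phi t := zero_lt_one.trans_le (one_le_Phi t)

theorem le_Phi (t : ℝ) : t ≤ Phi t := by
  rcases le_or_gt t 1 with h | h
  · exact h.trans (one_le_Phi t)
  · rw [Phi_eq_mul_Phi_log h.le]
    nlinarith [one_le_Phi (Real.log t)]

theorem Phi_mono : Monotone Phi := by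
  intro s t
  induction t using log_induction generalizing s with
  | base t h =>
    intro hst
    rw [Phi_of_le_one h, Phi_of_le_one (hst.trans h)]
  | step t h ih =>
    intro hst
    rcases le_or_gt s 1 with hs | hs
    · rw [Phi_of_le_one hs]
      exact one_le_Phi t
    · rw [Phi_eq_mul_Phi_log h.le, Phi_eq_mul_Phi_log hs.le]
      exact mul_le_mul hst (ih (Real.log_le_log (by linarith) hst)) (Phi_pos _).le (by linarith)

/-- A primitive of `1 / Phi`, characterized by being the identity on `(-∞, 1]` and satisfying
`logStar t = 1 + logStar (log t)` for `1 ≤ t`. -/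
noncomputable def logStar (t : ℝ) : ℝ :=
  iterCount t + logIter (iterCount t) t

theorem logStar_of_le_one {t : ℝ} (h : t ≤ 1) : logStar t = t := by
  simp [logStar, iterCount_of_le_one h, logIter]

theorem logStar_eq_one_add {t : ℝ} (h : 1 ≤ t) : logStar t = 1 + logStar (Real.log t) := by
  rcases h.eq_or_lt with rfl | h
  · simp [logStar_of_le_one]
  · rw [logStar, logStar, iterCount_of_one_lt h, logIter_succ']
    push_cast
    ring

theorem sub_div_Phi_le_logStar_sub {s t : ℝ} (hst : s ≤ t) :
    (t - s) / Phi t ≤ logStar t - logStar s := by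
  induction t using log_induction generalizing s with
  | base t h =>
    rw [Phi_of_le_one h, logStar_of_le_one h, logStar_of_le_one (hst.trans h), div_one]
  | step t h ih =>
    have key : ∀ s, 1 ≤ s → s ≤ t → (t - s) / Phi t ≤ logStar t - logStar s := by
      intro s hs hst
      have ht : 0 < t := by linarith
      have hs0 : 0 < s := by linarith
      have hlog : (t - s) / t ≤ Real.log t - Real.log s := by
        have := Real.log_le_sub_one_of_pos (div_pos hs0 ht)
        rw [Real.log_div hs0.ne' ht.ne'] at this
        rw [sub_div, div_self ht.ne']
        linarith
      rw [Phi_eq_mul_Phi_log h.le, logStar_eq_one_add h.le, logStar_eq_one_add hs, ← div_div]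
      have := ih (Real.log_le_log hs0 hst)
      have h2 := div_le_div_of_nonneg_right hlog (Phi_pos (Real.log t)).le
      linarith
    rcases le_or_gt 1 s with hs | hs
    · exact key s hs hst
    · have h1 := key 1 le_rfl h.le
      have h2 : (1 - s) / Phi t ≤ 1 - s := div_le_self (by linarith) (one_le_Phi t)
      rw [logStar_of_le_one le_rfl] at h1
      rw [logStar_of_le_one hs.le]
      have : (t - s) / Phi t = (t - 1) / Phi t + (1 - s) / Phi t := by ring
      linarith

theorem logStar_mono : Monotone logStar := by
  intro s t hst
  have := sub_div_Phi_le_logStar_sub hst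
  have h2 : 0 ≤ (t - s) / Phi t := div_nonneg (by linarith) (Phi_pos t).le
  linarith

theorem logStar_sub_le {s t : ℝ} (hst : s ≤ t) : logStar t - logStar s ≤ t - s := by
  induction t using log_induction generalizing s with
  | base t h => rw [logStar_of_le_one h, logStar_of_le_one (hst.trans h)]
  | step t h ih =>
    have key : ∀ s, 1 ≤ s → s ≤ t → logStar t - logStar s ≤ t - s := by
      intro s hs hst
      have hs0 : 0 < s := by linarith
      have hlog : Real.log t - Real.log s ≤ t - s := by
        have := Real.log_le_sub_one_of_pos (div_pos (hs0.trans_le hst) hs0)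
        rw [Real.log_div (by linarith) hs0.ne'] at this
        have h2 : t / s - 1 = (t - s) / s := by field_simp
        have h3 : (t - s) / s ≤ t - s := div_le_self (by linarith) hs
        linarith
      rw [logStar_eq_one_add h.le, logStar_eq_one_add hs]
      linarith [ih (Real.log_le_log hs0 hst)]
    rcases le_or_gt 1 s with hs | hs
    · exact key s hs hst
    · have h1 := key 1 le_rfl h.le
      rw [logStar_of_le_one le_rfl] at h1
      rw [logStar_of_le_one hs.le]
      linarith

/-- The sum of `1 / Phi (k log 2)` over `k` between `log₂ y - 1` and `(Phi (· log 2))⁻¹ (C y)` is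
bounded independently of `y`. -/
theorem exists_sum_inv_Phi_le {C : ℝ} (hC : 1 ≤ C) : ∃ M : ℝ, 0 ≤ M ∧ ∀ (y : ℝ) (n : ℕ),
    ∑ k ∈ Finset.range n, (if Phi (k * Real.log 2) < C * y ∧ y ≤ 2 ^ (k + 1) then
      1 / Phi (k * Real.log 2) else 0) ≤ M := by
  set c := Real.log 2 with hc
  have hc0 : 0 < c := Real.log_pos (by norm_num)
  have hlC : 0 ≤ Real.log C := Real.log_nonneg hC
  refine ⟨(1 + 2 * c + Real.log C) / c, by positivity, fun y n => ?_⟩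
  set z := max y 1 with hz
  have hz1 : 1 ≤ z := le_max_right _ _
  set A := logStar (Real.log z - 2 * c) with hA
  set B := logStar (C * z) with hB
  have hBA : B - A ≤ 1 + 2 * c + Real.log C := by
    rw [hB, logStar_eq_one_add (by nlinarith), Real.log_mul (by linarith) (by linarith)]
    have := logStar_sub_le (s := Real.log z - 2 * c) (t := Real.log C + Real.log z) (by linarith)
    linarith
  have hAB : A ≤ B := by
    refine logStar_mono ?_
    have := Real.log_le_sub_one_of_pos (zero_lt_one.trans_le hz1)
    nlinarith
  let F : ℕ → ℝ := fun k => max A (min (logStar (((k : ℝ) - 1) * c)) B)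
  have hF : Monotone F := by
    intro i j hij
    refine max_le_max le_rfl (min_le_min (logStar_mono ?_) le_rfl)
    have : (i : ℝ) ≤ j := by exact_mod_cast hij
    nlinarith
  have hterm : ∀ k : ℕ, (if Phi (k * c) < C * y ∧ y ≤ 2 ^ (k + 1) then
      1 / Phi (k * c) else 0) ≤ (F (k + 1) - F k) / c := by
    intro k
    split_ifs with h
    · obtain ⟨h1, h2⟩ := h
      have hlow : Real.log z - 2 * c ≤ ((k : ℝ) - 1) * c := by
        have hz2 : z ≤ 2 ^ (k + 1) := max_le h2 (one_le_pow₀ (by norm_num))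
        have := Real.log_le_log (by linarith) hz2
        rw [Real.log_pow] at this
        push_cast at this
        linarith
      have hkk : ((k : ℝ) - 1) * c ≤ k * c := by nlinarith
      have hup : (k : ℝ) * c ≤ C * z := by
        have : y ≤ z := le_max_left _ _
        nlinarith [le_Phi (k * c)]
      have e1 : F k = logStar (((k : ℝ) - 1) * c) := by
        simp only [F]
        rw [min_eq_left (logStar_mono (hkk.trans hup)), max_eq_right (logStar_mono hlow)]
      have e2 : F (k + 1) = logStar ((k : ℝ) * c) := by
        simp only [F]
        push_cast
        rw [add_sub_cancel_right, min_eq_left (logStar_mono hup),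
          max_eq_right (logStar_mono (hlow.trans hkk))]
      rw [e1, e2, le_div_iff₀ hc0]
      have := sub_div_Phi_le_logStar_sub hkk
      refine le_trans (le_of_eq ?_) this
      ring
    · exact div_nonneg (sub_nonneg.2 (hF k.le_succ)) hc0.le
  calc _ ≤ ∑ k ∈ Finset.range n, (F (k + 1) - F k) / c := Finset.sum_le_sum fun k _ => hterm k
    _ = (F n - F 0) / c := by rw [← Finset.sum_div, Finset.sum_range_sub]
    _ ≤ (1 + 2 * c + Real.log C) / c := by
      refine div_le_div_of_nonneg_right ?_ hc0.le
      have h1 : F n ≤ B := max_le hAB (min_le_right _ _)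
      have h2 : A ≤ F 0 := le_max_left _ _
      linarith

/-- The function `y ↦ |y| / Phi (2 ^ k)`, cut off outside `δ Phi (k log 2) < |y| ≤ 2 ^ (k + 1)`. -/
noncomputable def midPart (δ : ℝ) (k : ℕ) (y : ℝ) : ℝ :=
  if δ * Phi (k * Real.log 2) < |y| ∧ |y| ≤ 2 ^ (k + 1) then
    |y| / (2 ^ k * Phi (k * Real.log 2)) else 0

theorem midPart_nonneg (δ : ℝ) (k : ℕ) (y : ℝ) : 0 ≤ midPart δ k y := by
  have := Phi_pos (k * Real.log 2)
  rw [midPart]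
  split_ifs <;> positivity

theorem measurable_midPart (δ : ℝ) (k : ℕ) : Measurable (midPart δ k) := by
  refine Measurable.ite ?_ (by fun_prop) measurable_const
  exact (measurableSet_lt measurable_const measurable_norm).inter
    (measurableSet_le measurable_norm measurable_const)

theorem exists_tsum_midPart_le {δ : ℝ} (hδ : 0 < δ) (hδ1 : δ ≤ 1) : ∃ M : ℝ, 0 ≤ M ∧ ∀ y : ℝ,
    ∑' k : ℕ, 2 ^ (k + 1) * ENNReal.ofReal (midPart δ k y) ≤ ENNReal.ofReal (M * |y|) := by
  obtain ⟨M, hM, h⟩ := exists_sum_inv_Phi_le ((one_le_inv₀ hδ).2 hδ1)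
  refine ⟨2 * M, by positivity, fun y => ?_⟩
  refine ENNReal.tsum_le_of_sum_range_le fun n => ?_
  have e : ∀ k : ℕ, (2 : ENNReal) ^ (k + 1) * ENNReal.ofReal (midPart δ k y) =
      ENNReal.ofReal (2 ^ (k + 1) * midPart δ k y) := by
    intro k
    rw [ENNReal.ofReal_mul (by positivity), ENNReal.ofReal_pow (by norm_num)]
    norm_num
  simp only [e]
  rw [← ENNReal.ofReal_sum_of_nonneg
    fun k _ => mul_nonneg (by positivity) (midPart_nonneg δ k y)]
  refine ENNReal.ofReal_le_ofReal ?_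
  calc _ = 2 * |y| * ∑ k ∈ Finset.range n,
        (if Phi (k * Real.log 2) < δ⁻¹ * |y| ∧ |y| ≤ 2 ^ (k + 1) then
          1 / Phi (k * Real.log 2) else 0) := by
        rw [Finset.mul_sum]
        refine Finset.sum_congr rfl fun k _ => ?_
        simp only [midPart, lt_inv_mul_iff₀ hδ]
        split_ifs
        · have := (Phi_pos (k * Real.log 2)).ne'
          field_simp
          ring
        · simp
    _ ≤ 2 * |y| * M := mul_le_mul_of_nonneg_left (h _ _) (by positivity)
    _ = 2 * M * |y| := by ring

section IdenticallyDistributed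

variable {X : Type*} [MeasurableSpace X] {μ : Measure X} {f : X → ℝ} {S : ℕ → X → X}

theorem ae_tendsto_sum_midPart (hS : ∀ n, MeasurePreserving (S n) μ μ) (hf : Integrable f μ)
    {δ : ℝ} (hδ : 0 < δ) (hδ1 : δ ≤ 1) :
    ∀ᵐ x ∂μ, Tendsto (fun k : ℕ => ∑ n ∈ Finset.Icc 1 (2 ^ (k + 1)), midPart δ k (f (S n x)))
      atTop (nhds 0) := by
  obtain ⟨M, hM, h⟩ := exists_tsum_midPart_le hδ hδ1
  have hmeas : ∀ k, Measurable fun y => ENNReal.ofReal (midPart δ k y) :=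
    fun k => (measurable_midPart δ k).ennreal_ofReal
  have hcomp : ∀ k, AEMeasurable (fun x => ENNReal.ofReal (midPart δ k (f x))) μ :=
    fun k => (hmeas k).comp_aemeasurable hf.aemeasurable
  have hcompS : ∀ k n, AEMeasurable (fun x => ENNReal.ofReal (midPart δ k (f (S n x)))) μ :=
    fun k n => (hcomp k).comp_quasiMeasurePreserving (hS n).quasiMeasurePreserving
  have hint : ∀ k n, ∫⁻ x, ENNReal.ofReal (midPart δ k (f (S n x))) ∂μ =
      ∫⁻ x, ENNReal.ofReal (midPart δ k (f x)) ∂μ := by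
    intro k n
    have hk := hcomp k
    rw [← (hS n).map_eq] at hk
    have := lintegral_map' hk (hS n).measurable.aemeasurable
    rw [(hS n).map_eq] at this
    exact this.symm
  let w : ℕ → X → ENNReal := fun k x =>
    ∑ n ∈ Finset.Icc 1 (2 ^ (k + 1)), ENNReal.ofReal (midPart δ k (f (S n x)))
  have hw : ∀ k, AEMeasurable (w k) μ := fun k =>
    Finset.aemeasurable_fun_sum _ fun n _ => hcompS k n
  have hsum : ∫⁻ x, ∑' k, w k x ∂μ ≠ ⊤ := by
    have : ∫⁻ x, ∑' k, w k x ∂μ =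
        ∫⁻ x, ∑' k : ℕ, 2 ^ (k + 1) * ENNReal.ofReal (midPart δ k (f x)) ∂μ := by
      rw [lintegral_tsum hw, lintegral_tsum fun k => (hcomp k).const_mul _]
      congr 1
      ext k
      rw [lintegral_finsetSum' _ fun n _ => hcompS k n, lintegral_const_mul'' _ (hcomp k)]
      simp [hint]
    rw [this]
    refine ne_top_of_le_ne_top ?_ (lintegral_mono fun x => h (f x))
    exact (hf.abs.const_mul M).lintegral_lt_top.ne
  filter_upwards [ae_lt_top' (AEMeasurable.tsum hw) hsum] with x hx
  have ht := ENNReal.tendsto_atTop_zero_of_tsum_ne_top hx.ne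
  have := (ENNReal.tendsto_toReal ENNReal.zero_ne_top).comp ht
  refine this.congr fun k => ?_
  simp only [w, Function.comp]
  rw [← ENNReal.ofReal_sum_of_nonneg fun n _ => midPart_nonneg _ _ _,
    ENNReal.toReal_ofReal (Finset.sum_nonneg fun n _ => midPart_nonneg _ _ _)]

theorem ae_eventually_abs_le [IsProbabilityMeasure μ] (hS : ∀ n, MeasurePreserving (S n) μ μ)
    (hf : Integrable f μ) : ∀ᵐ x ∂μ, ∀ᶠ n : ℕ in atTop, |f (S n x)| ≤ n := by
  let _ : MeasureSpace X := ⟨μ⟩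
  have h := ProbabilityTheory.tsum_prob_mem_Ioi_lt_top (X := fun x => |f x|) hf.abs
    fun x => abs_nonneg (f x)
  have e : ∀ n : ℕ, μ {x | |f (S n x)| ∈ Set.Ioi (n : ℝ)} = μ {x | |f x| ∈ Set.Ioi (n : ℝ)} := by
    intro n
    refine (hS n).measure_preimage (s := {x | |f x| ∈ Set.Ioi (n : ℝ)}) ?_
    exact hf.abs.aemeasurable.nullMeasurable measurableSet_Ioi
  have h2 : ∑' n : ℕ, μ {x | |f (S n x)| ∈ Set.Ioi (n : ℝ)} ≠ ⊤ := by
    simp only [e]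
    exact h.ne
  filter_upwards [ae_eventually_notMem h2] with x hx
  filter_upwards [hx] with n hn
  simpa using hn

/-- Only terms with `|u n| ≤ 2 ^ (k + 1)`, up to a bounded amount, enter a sum of length at most
`2 ^ (k + 1)` as soon as `|u n| ≤ n` eventually. -/
theorem exists_abs_sum_div_Phi_le {u : ℕ → ℝ} (hu : ∀ᶠ n : ℕ in atTop, |u n| ≤ n) :
    ∃ R : ℝ, ∀ {δ : ℝ} {N : ℕ}, 0 < δ → N ≠ 0 →
      |(1 / Phi N) * ∑ n ∈ Finset.Icc 1 N, u n| ≤ R / 2 ^ Nat.log 2 N + 2 * δ +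
        ∑ n ∈ Finset.Icc 1 (2 ^ (Nat.log 2 N + 1)), midPart δ (Nat.log 2 N) (u n) := by
  obtain ⟨n₀, hn₀⟩ := eventually_atTop.1 hu
  refine ⟨∑ n ∈ Finset.range n₀, |u n|, fun {δ N} hδ hN => ?_⟩
  set k := Nat.log 2 N
  set P := Phi (k * Real.log 2)
  have hP : 0 < P := Phi_pos _
  have hlow : 2 ^ k ≤ N := Nat.pow_log_le_self 2 hN
  have hup : N ≤ 2 ^ (k + 1) := (Nat.lt_pow_succ_log_self (by norm_num) N).le
  have hPhi : 2 ^ k * P ≤ Phi N := by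
    have h1 : Phi ((2 : ℝ) ^ k) = 2 ^ k * P := by
      rw [Phi_eq_mul_Phi_log (one_le_pow₀ (by norm_num)), Real.log_pow]
    rw [← h1]
    exact Phi_mono (by exact_mod_cast hlow)
  have hQ : 0 < 2 ^ k * P := by positivity
  have hterm : ∀ n ∈ Finset.Icc 1 (2 ^ (k + 1)), |u n| ≤
      (if n < n₀ then |u n| else 0) + δ * P + 2 ^ k * P * midPart δ k (u n) := by
    intro n hn
    have hδP : 0 < δ * P := by positivity
    have hm := mul_nonneg hQ.le (midPart_nonneg δ k (u n))
    split_ifs with h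
    · linarith
    · have hle : |u n| ≤ 2 ^ (k + 1) :=
        (hn₀ n (not_lt.1 h)).trans (by exact_mod_cast (Finset.mem_Icc.1 hn).2)
      rcases le_or_gt |u n| (δ * P) with h' | h'
      · linarith
      · rw [midPart, if_pos ⟨h', hle⟩, mul_div_cancel₀ _ hQ.ne']
        linarith
  have hhead : ∑ n ∈ Finset.Icc 1 (2 ^ (k + 1)), (if n < n₀ then |u n| else 0) ≤
      ∑ n ∈ Finset.range n₀, |u n| := by
    rw [← Finset.sum_filter]
    refine Finset.sum_le_sum_of_subset_of_nonneg (fun n hn => ?_) fun _ _ _ => abs_nonneg _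
    exact Finset.mem_range.2 (Finset.mem_filter.1 hn).2
  have hR : 0 ≤ ∑ n ∈ Finset.range n₀, |u n| := Finset.sum_nonneg fun _ _ => abs_nonneg _
  have hmain : |∑ n ∈ Finset.Icc 1 N, u n| ≤ ∑ n ∈ Finset.range n₀, |u n| +
      2 ^ (k + 1) * (δ * P) +
      2 ^ k * P * ∑ n ∈ Finset.Icc 1 (2 ^ (k + 1)), midPart δ k (u n) := by
    calc |∑ n ∈ Finset.Icc 1 N, u n| ≤ ∑ n ∈ Finset.Icc 1 N, |u n| :=
          Finset.abs_sum_le_sum_abs _ _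
      _ ≤ ∑ n ∈ Finset.Icc 1 (2 ^ (k + 1)), |u n| :=
          Finset.sum_le_sum_of_subset_of_nonneg (Finset.Icc_subset_Icc_right hup)
            fun _ _ _ => abs_nonneg _
      _ ≤ _ := Finset.sum_le_sum hterm
      _ ≤ _ := by
          rw [Finset.sum_add_distrib, Finset.sum_add_distrib, Finset.mul_sum,
            Finset.sum_const, Nat.card_Icc, nsmul_eq_mul]
          push_cast [Nat.add_sub_cancel]
          linarith
  rw [abs_mul, abs_of_pos (one_div_pos.2 (Phi_pos _)), one_div_mul_eq_div]
  calc _ ≤ |∑ n ∈ Finset.Icc 1 N, u n| / (2 ^ k * P) :=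
        div_le_div_of_nonneg_left (abs_nonneg _) hQ hPhi
    _ ≤ _ / (2 ^ k * P) := div_le_div_of_nonneg_right hmain hQ.le
    _ = (∑ n ∈ Finset.range n₀, |u n|) / (2 ^ k * P) + 2 * δ +
        ∑ n ∈ Finset.Icc 1 (2 ^ (k + 1)), midPart δ k (u n) := by
        field_simp
        ring
    _ ≤ _ := by
        have : (∑ n ∈ Finset.range n₀, |u n|) / (2 ^ k * P) ≤
            (∑ n ∈ Finset.range n₀, |u n|) / 2 ^ k :=
          div_le_div_of_nonneg_left hR (by positivity)
            (le_mul_of_one_le_right (by positivity) (one_le_Phi _))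
        linarith

/-- The averages of an integrable function along an arbitrary sequence of measure-preserving maps,
normalized by `Phi`, converge to `0` almost everywhere. -/
theorem ae_tendsto_sum_div_Phi [IsProbabilityMeasure μ] (hS : ∀ n, MeasurePreserving (S n) μ μ)
    (hf : Integrable f μ) :
    ∀ᵐ x ∂μ, Tendsto (fun N : ℕ => (1 / Phi N) * ∑ n ∈ Finset.Icc 1 N, f (S n x))
      atTop (nhds 0) := by
  have hmid : ∀ᵐ x ∂μ, ∀ m : ℕ, Tendsto (fun k : ℕ =>
      ∑ n ∈ Finset.Icc 1 (2 ^ (k + 1)), midPart (1 / ((m : ℝ) + 1)) k (f (S n x)))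
      atTop (nhds 0) :=
    ae_all_iff.2 fun m => ae_tendsto_sum_midPart hS hf (by positivity)
      ((div_le_one (by positivity)).2 (by linarith [Nat.cast_nonneg (α := ℝ) m]))
  filter_upwards [hmid, ae_eventually_abs_le hS hf] with x hx hx'
  obtain ⟨R, hR⟩ := exists_abs_sum_div_Phi_le hx'
  have hlog : Tendsto (Nat.log 2) atTop atTop :=
    tendsto_atTop.2 fun b => (eventually_ge_atTop (2 ^ b)).mono fun N hN =>
      Nat.le_log_of_pow_le (by norm_num) hN
  rw [Metric.tendsto_atTop']
  intro ε hε
  obtain ⟨m, hm⟩ := exists_nat_one_div_lt (show 0 < ε / 4 by positivity)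
  have hRt : Tendsto (fun k : ℕ => R / (2 : ℝ) ^ k) atTop (nhds 0) :=
    tendsto_const_nhds.div_atTop (tendsto_pow_atTop_atTop_of_one_lt (by norm_num))
  have hev := hlog.eventually
    ((hRt.add (hx m)).eventually_lt_const (show (0 : ℝ) + 0 < ε / 2 by linarith))
  obtain ⟨N₀, hN₀⟩ := eventually_atTop.1 hev
  refine ⟨N₀, fun N hN => ?_⟩
  rw [Real.dist_eq, sub_zero]
  have h1 := hR (δ := 1 / ((m : ℝ) + 1)) (by positivity) (by omega : N ≠ 0)
  have h2 := hN₀ N hN.le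
  linarith

end IdenticallyDistributed

theorem stmt0 {X : Type*} [MeasurableSpace X] (μ : Measure X) [IsProbabilityMeasure μ]
    (T : X → X) (hT : MeasurePreserving T μ μ) (a : ℕ → ℕ) (f : X → ℝ)
    (hf : Integrable f μ) :
    ∀ᵐ x ∂μ, Tendsto
      (fun N : ℕ => (1 / Phi N) * ∑ n ∈ Finset.Icc 1 N, f (T^[a n] x))
      atTop (nhds 0) :=
  ae_tendsto_sum_div_Phi (fun n => hT.iterate (a n)) hf
end

section
/- Let (h_n)_{n≥1} be a nondecreasing sequence of real numbers with h_1 > 0, and for n ≥ 2 set c_n = (h_n − h_{n−1})/h_n. If d = sup_{y>0} y·#{n ≥ 2 : c_n ≥ y} is finite, then there exists K > 0 such that h_n ≤ K·n^d for all n ≥ 1. -/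
open Filter

/-- The Bernoulli-type inequality `(1 - 1/u)^d ≤ u / (u + d)`, cleared of divisions. -/
lemma sub_one_rpow_mul_add_le {u d : ℝ} (hd : 0 ≤ d) (hu : 1 ≤ u) :
    (u - 1) ^ d * ((u + d) / u) ≤ u ^ d := by
  have hu0 : 0 < u := by linarith
  have hle : u - 1 ≤ u * Real.exp (-(1 / u)) := by
    have h := Real.add_one_le_exp (-(1 / u))
    calc u - 1 = u * (-(1 / u) + 1) := by field_simp; ring
      _ ≤ _ := by gcongr
  have hpow : (u - 1) ^ d ≤ u ^ d * Real.exp (-(d / u)) := by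
    calc (u - 1) ^ d ≤ (u * Real.exp (-(1 / u))) ^ d :=
          Real.rpow_le_rpow (by linarith) hle hd
      _ = u ^ d * Real.exp (-(d / u)) := by
          rw [Real.mul_rpow hu0.le (Real.exp_pos _).le, ← Real.exp_mul]
          congr 2
          ring
  have hfrac : (u + d) / u ≤ Real.exp (d / u) := by
    have h := Real.add_one_le_exp (d / u)
    calc (u + d) / u = d / u + 1 := by field_simp; ring
      _ ≤ _ := h
  calc (u - 1) ^ d * ((u + d) / u)
      ≤ (u ^ d * Real.exp (-(d / u))) * Real.exp (d / u) := by gcongr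
    _ = u ^ d := by rw [mul_assoc, ← Real.exp_add]; simp

lemma Finset.prod_le_pow_card_of_nonneg {s : Finset ℕ} {r : ℕ → ℝ} {G : ℝ}
    (hr : ∀ k ∈ s, 0 ≤ r k) (hG : ∀ k ∈ s, r k ≤ G) : ∏ k ∈ s, r k ≤ G ^ s.card :=
  (Finset.prod_le_prod hr hG).trans_eq (Finset.prod_const G)

/-- A sequence of ratios `r` whose associated `1 - 1/r` has weak `ℓ¹` norm at most `d` on `S`
is bounded on `S`. -/
lemma exists_bound_of_weak_l1 {r : ℕ → ℝ} {S : Set ℕ} {d : ℝ} (hr : ∀ k ∈ S, 1 ≤ r k)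
    (hd : ∀ y : ℝ, 0 < y → ∀ s : Finset ℕ,
      (∀ n ∈ s, n ∈ S ∧ y ≤ 1 - 1 / r n) → y * s.card ≤ d) :
    ∃ G : ℝ, 1 ≤ G ∧ ∀ k ∈ S, r k ≤ G := by
  have hfin : {k | k ∈ S ∧ 1 / 2 ≤ 1 - 1 / r k}.Finite := by
    by_contra hinf
    obtain ⟨n, hn⟩ := exists_nat_gt (2 * d)
    obtain ⟨t, ht, hcard⟩ := Set.Infinite.exists_subset_card_eq hinf n
    have := hd (1 / 2) (by norm_num) t fun k hk => ht hk
    rw [hcard] at this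
    linarith
  obtain ⟨M, hM⟩ := (hfin.image r).bddAbove
  refine ⟨max M 2, le_max_of_le_right (by norm_num), fun k hk => ?_⟩
  by_cases hc : 1 / 2 ≤ 1 - 1 / r k
  · exact le_max_of_le_left (hM ⟨k, ⟨hk, hc⟩, rfl⟩)
  · refine le_max_of_le_right ?_
    have hpos : 0 < r k := by linarith [hr k hk]
    have hlt : 1 / 2 < 1 / r k := by linarith
    exact (lt_of_one_div_lt_one_div two_pos hlt |>.le)

/-- Products of ratios `r` whose associated `1 - 1/r` has weak `ℓ¹` norm at most `d` grow at most
like the `d`-th power of the number of factors. -/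
lemma prod_le_of_weak_l1 {r : ℕ → ℝ} {S : Set ℕ} {d G : ℝ} (hr : ∀ k ∈ S, 1 ≤ r k)
    (hd0 : 0 ≤ d)
    (hd : ∀ y : ℝ, 0 < y → ∀ s : Finset ℕ,
      (∀ n ∈ s, n ∈ S ∧ y ≤ 1 - 1 / r n) → y * s.card ≤ d)
    (hG : 1 ≤ G) (hrG : ∀ k ∈ S, r k ≤ G) {N : ℕ} (hN : d + 1 ≤ N) {t : ℕ} (ht : N ≤ t) :
    ∀ s : Finset ℕ, (∀ k ∈ s, k ∈ S) → s.card = t →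
      ∏ k ∈ s, r k ≤ G ^ N * ((t : ℝ) - d) ^ d := by
  induction t, ht using Nat.le_induction with
  | base =>
    intro s hs hcard
    have hprod : ∏ k ∈ s, r k ≤ G ^ N := by
      rw [← hcard]
      exact Finset.prod_le_pow_card_of_nonneg (fun k hk => by linarith [hr k (hs k hk)])
        fun k hk => hrG k (hs k hk)
    have hone : 1 ≤ ((N : ℝ) - d) ^ d := Real.one_le_rpow (by linarith) hd0
    exact hprod.trans (le_mul_of_one_le_right (by positivity) hone)
  | succ t ht ih =>
    intro s hs hcard
    have htN : (N : ℝ) ≤ t := by exact_mod_cast ht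
    have hne : s.Nonempty := Finset.card_pos.mp (by omega)
    obtain ⟨m, hm, hmin⟩ := s.exists_min_image r hne
    have hrm : 0 < r m := by linarith [hr m (hs m hm)]
    have hcm : (1 - 1 / r m) * (t + 1 : ℝ) ≤ d := by
      rcases le_or_gt (1 - 1 / r m) 0 with hc | hc
      · exact (mul_nonpos_of_nonpos_of_nonneg hc (by positivity)).trans hd0
      · have := hd _ hc s fun k hk => ⟨hs k hk, by
          have := one_div_le_one_div_of_le hrm (hmin k hk)
          linarith⟩
        rw [hcard] at this
        exact_mod_cast this
    have hle : r m ≤ ((t + 1 - d : ℝ) + d) / (t + 1 - d) := by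
      rw [le_div_iff₀ (by linarith)]
      have h := mul_le_mul_of_nonneg_left hcm hrm.le
      have : r m * ((1 - 1 / r m) * (t + 1 : ℝ)) = (r m - 1) * (t + 1) := by field_simp
      rw [this] at h
      linarith
    have hrest := ih (s.erase m) (fun k hk => hs k (Finset.mem_of_mem_erase hk))
      (by rw [Finset.card_erase_of_mem hm, hcard]; simp)
    have hstep := sub_one_rpow_mul_add_le (u := (t + 1 - d : ℝ)) hd0 (by linarith)
    have hbase : (0 : ℝ) ≤ (t - d : ℝ) ^ d := Real.rpow_nonneg (by linarith) d
    rw [← Finset.prod_erase_mul s r hm]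
    calc (∏ k ∈ s.erase m, r k) * r m
        ≤ (G ^ N * ((t : ℝ) - d) ^ d) * (((t + 1 - d : ℝ) + d) / (t + 1 - d)) := by
          gcongr
      _ = G ^ N * (((t + 1 - d : ℝ) - 1) ^ d * (((t + 1 - d : ℝ) + d) / (t + 1 - d))) := by
          rw [show (t + 1 - d : ℝ) - 1 = t - d by ring]; ring
      _ ≤ G ^ N * (((t + 1 : ℕ) : ℝ) - d) ^ d := by
          push_cast
          gcongr

theorem stmt15 (h : ℕ → ℝ) (h1 : 0 < h 1)
    (hmono : ∀ n : ℕ, 1 ≤ n → h n ≤ h (n + 1))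
    (d : ℝ)
    (hd : ∀ y : ℝ, 0 < y → ∀ s : Finset ℕ,
      (∀ n ∈ s, 2 ≤ n ∧ y ≤ (h n - h (n - 1)) / h n) → y * s.card ≤ d) :
    ∃ K : ℝ, 0 < K ∧ ∀ n : ℕ, 1 ≤ n → h n ≤ K * (n : ℝ) ^ d := by
  have hd0 : 0 ≤ d := by simpa using hd 1 one_pos ∅ (by simp)
  have hpos : ∀ n, 1 ≤ n → 0 < h n := fun n hn => by
    induction n, hn using Nat.le_induction with
    | base => exact h1
    | succ n hn ih => exact ih.trans_le (hmono n hn)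
  have hprod : ∀ n, 1 ≤ n → h n = h 1 * ∏ k ∈ Finset.Icc 2 n, h k / h (k - 1) := fun n hn => by
    induction n, hn using Nat.le_induction with
    | base => simp
    | succ n hn ih =>
      rw [Finset.prod_Icc_succ_top (by omega), ← mul_assoc, ← ih, Nat.add_sub_cancel]
      field_simp [(hpos n hn).ne']
  let r : ℕ → ℝ := fun k => h k / h (k - 1)
  have hr : ∀ k ∈ Set.Ici 2, 1 ≤ r k := fun k hk => by
    have hk2 : 2 ≤ k := hk
    have hm := hmono (k - 1) (by omega)
    rw [Nat.sub_add_cancel (by omega)] at hm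
    exact (one_le_div (hpos (k - 1) (by omega))).mpr hm
  have hdr : ∀ y : ℝ, 0 < y → ∀ s : Finset ℕ,
      (∀ n ∈ s, n ∈ Set.Ici 2 ∧ y ≤ 1 - 1 / r n) → y * s.card ≤ d := fun y hy s hs =>
    hd y hy s fun n hn => by
      obtain ⟨hn2, hyn⟩ := hs n hn
      have hn2' : 2 ≤ n := hn2
      refine ⟨hn2, ?_⟩
      rwa [sub_div, div_self (hpos n (by omega)).ne', ← one_div_div (h n)]
  obtain ⟨G, hG, hrG⟩ := exists_bound_of_weak_l1 hr hdr
  obtain ⟨N, hN⟩ := exists_nat_ge (d + 1)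
  refine ⟨h 1 * G ^ N, by positivity, fun n hn => ?_⟩
  have hmem : ∀ k ∈ Finset.Icc 2 n, k ∈ Set.Ici 2 := fun k hk => (Finset.mem_Icc.mp hk).1
  have hcard : (Finset.Icc 2 n).card = n - 1 := by simp
  have hone : (1 : ℝ) ≤ n := by exact_mod_cast hn
  rw [hprod n hn, mul_assoc]
  refine mul_le_mul_of_nonneg_left ?_ h1.le
  rcases le_total N (n - 1) with hNn | hNn
  · have hNn' : (N : ℝ) ≤ (n - 1 : ℕ) := by exact_mod_cast hNn
    refine (prod_le_of_weak_l1 hr hd0 hdr hG hrG hN hNn _ hmem hcard).trans ?_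
    gcongr
    · linarith
    · have : ((n - 1 : ℕ) : ℝ) ≤ n := by exact_mod_cast Nat.sub_le n 1
      linarith
  · calc ∏ k ∈ Finset.Icc 2 n, r k ≤ G ^ (n - 1) := by
          rw [← hcard]
          exact Finset.prod_le_pow_card_of_nonneg (fun k hk => by linarith [hr k (hmem k hk)])
            fun k hk => hrG k (hmem k hk)
      _ ≤ G ^ N := pow_le_pow_right₀ hG hNn
      _ ≤ G ^ N * (n : ℝ) ^ d :=
          le_mul_of_one_le_right (by positivity) (Real.one_le_rpow hone hd0)
end

section
/- Let (t_n)_{n≥1} be an increasing sequence of real numbers with t_n → ∞, and for N ∈ ℕ let h(N) = #{n : t_n ≤ N}. Suppose that for every k ∈ ℕ, limsup_{N→∞} h(N)/N^k = ∞. For g ∈ L^1(ℝ) and N with h(N) ≥ 1 define B_N g(y) = (1/h(N))·Σ_{n : t_n ≤ N} g(y − t_n). Then the maximal operator g ↦ sup_N B_N g fails to be weak (1,1): there is no constant C > 0 with ‖sup_N B_N g‖_{1,∞} ≤ C·‖g‖_1 for all g ∈ L^1(ℝ); in fact, for g the indicator function of [0,2), ‖sup_N B_N g‖_{1,∞} =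 ∞. -/
open MeasureTheory Filter ENNReal

/-- `h(N) = #{n ≥ 1 : t_n ≤ N}`. -/
noncomputable def hcount (t : ℕ → ℝ) (N : ℕ) : ℕ :=
  Nat.card {n : ℕ | 1 ≤ n ∧ t n ≤ (N : ℝ)}

/-- `B_N g (y) = (1/h(N)) · Σ_{n ≥ 1, t_n ≤ N} g (y - t_n)`. -/
noncomputable def BN (t : ℕ → ℝ) (N : ℕ) (g : ℝ → ℝ) (y : ℝ) : ℝ :=
  (hcount t N : ℝ)⁻¹ *
    ∑' n : ℕ, if 1 ≤ n ∧ t n ≤ (N : ℝ) then g (y - t n) else 0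

/-- The weak `L^p` (quasi-)norm of an extended-nonnegative-valued function. -/
noncomputable def wnormE {X : Type*} [MeasurableSpace X] (μ : Measure X) (p : ℝ)
    (g : X → ℝ≥0∞) : ℝ≥0∞ :=
  ⨆ (y : ℝ) (_ : 0 < y), ENNReal.ofReal y * (μ {x | ENNReal.ofReal y ≤ g x}) ^ (1 / p)

/-- A finite family with weak `ℓ¹` norm at most `C` has sum at most `C` times a harmonic number. -/
theorem sum_le_mul_harmonic_of_weak_bound {ι : Type*} [DecidableEq ι] (f : ι → ℝ) {C : ℝ}
    (hC : 0 ≤ C) (S : Finset ι)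
    (hS : ∀ l : ℝ, 0 < l → l * ((S.filter fun i => l ≤ f i).card : ℝ) ≤ C) :
    ∑ i ∈ S, f i ≤ C * (harmonic S.card : ℝ) := by
  induction hn : S.card generalizing S with
  | zero => simp [Finset.card_eq_zero.mp hn]
  | succ n ih =>
    have hne : S.Nonempty := Finset.card_pos.mp (by omega)
    obtain ⟨a, ha, hmin⟩ := S.exists_min_image f hne
    have herase : ∑ i ∈ S.erase a, f i ≤ C * (harmonic n : ℝ) := by
      refine ih _ (fun l hl => le_trans ?_ (hS l hl)) (by rw [Finset.card_erase_of_mem ha, hn]; rfl)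
      gcongr
      exact Finset.erase_subset a S
    have hmin_le : f a ≤ C * ((n : ℝ) + 1)⁻¹ := by
      rcases le_or_gt (f a) 0 with h0 | h0
      · exact h0.trans (by positivity)
      · have h := hS (f a) h0
        rw [Finset.filter_true_of_mem hmin, hn] at h
        push_cast at h
        rwa [← div_eq_mul_inv, le_div_iff₀ (by positivity)]
    rw [← Finset.add_sum_erase S f ha, harmonic_succ]
    push_cast
    linarith

theorem finite_index_le {t : ℕ → ℝ} (htop : Tendsto t atTop atTop) (x : ℝ) :
    {n : ℕ | 1 ≤ n ∧ t n ≤ x}.Finite := by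
  obtain ⟨K, hK⟩ := eventually_atTop.mp (htop.eventually_gt_atTop x)
  refine (Set.finite_lt_nat K).subset fun n hn => ?_
  by_contra h
  exact absurd (hK n (not_lt.mp h)) (not_lt.mpr hn.2)

theorem hcount_eq_card {t : ℕ → ℝ} (htop : Tendsto t atTop atTop) (N : ℕ) :
    hcount t N = (finite_index_le htop (N : ℝ)).toFinset.card := by
  rw [hcount, ← Set.ncard_eq_toFinset_card _ (finite_index_le htop (N : ℝ))]
  rfl

theorem hcount_mono {t : ℕ → ℝ} (htop : Tendsto t atTop atTop) : Monotone (hcount t) := by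
  intro M N hMN
  rw [hcount_eq_card htop, hcount_eq_card htop]
  refine Finset.card_le_card fun n hn => ?_
  simp only [Set.Finite.mem_toFinset, Set.mem_ofPred_eq] at hn ⊢
  exact ⟨hn.1, hn.2.trans (by exact_mod_cast hMN)⟩

/-- On `[m + 1, m + 2)` the average `B_{m+1}` of the indicator of `[0, 2)` is at least the relative
increment of `h` from `m` to `m + 1`. -/
theorem one_sub_div_le_BN {t : ℕ → ℝ} (htop : Tendsto t atTop atTop) (m : ℕ)
    (hm : 1 ≤ hcount t (m + 1)) {y : ℝ} (hy : y ∈ Set.Ico ((m : ℝ) + 1) (m + 2)) :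
    1 - (hcount t m : ℝ) / hcount t (m + 1) ≤
      BN t (m + 1) ((Set.Ico (0 : ℝ) 2).indicator fun _ => (1 : ℝ)) y := by
  have hpos : (0 : ℝ) < hcount t (m + 1) := by exact_mod_cast hm
  have hnonneg : ∀ x : ℝ, 0 ≤ (Set.Ico (0 : ℝ) 2).indicator (fun _ => (1 : ℝ)) x :=
    Set.indicator_nonneg fun _ _ => zero_le_one
  set F := (finite_index_le htop ((m + 1 : ℕ) : ℝ)).toFinset with hF
  set F' := (finite_index_le htop (m : ℝ)).toFinset with hF'
  have hsum : (∑' n : ℕ, if 1 ≤ n ∧ t n ≤ ((m + 1 : ℕ) : ℝ) then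
      (Set.Ico (0 : ℝ) 2).indicator (fun _ => (1 : ℝ)) (y - t n) else 0) =
      ∑ n ∈ F, (Set.Ico (0 : ℝ) 2).indicator (fun _ => (1 : ℝ)) (y - t n) := by
    rw [tsum_eq_sum (s := F)]
    · refine Finset.sum_congr rfl fun n hn => if_pos ?_
      simpa [hF] using hn
    · intro n hn
      refine if_neg fun h => hn ?_
      simpa [hF] using h
  have hsub : F' ⊆ F := by
    intro n hn
    simp only [hF, hF', Set.Finite.mem_toFinset, Set.mem_ofPred_eq] at hn ⊢
    exact ⟨hn.1, hn.2.trans (by push_cast; linarith)⟩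
  have hle : ((F \ F').card : ℝ) ≤
      ∑ n ∈ F, (Set.Ico (0 : ℝ) 2).indicator (fun _ => (1 : ℝ)) (y - t n) := by
    refine le_trans ?_ (Finset.sum_le_sum_of_subset_of_nonneg (s := F \ F') Finset.sdiff_subset
      fun n _ _ => hnonneg _)
    rw [Finset.card_eq_sum_ones, Nat.cast_sum]
    refine Finset.sum_le_sum fun n hn => ?_
    simp only [hF, hF', Finset.mem_sdiff, Set.Finite.mem_toFinset, Set.mem_ofPred_eq, not_and,
      not_le] at hn
    have h1 := hn.1.2
    have h2 := hn.2 hn.1.1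
    push_cast at h1
    rw [Set.indicator_of_mem]
    · simp
    · constructor <;> linarith [hy.1, hy.2]
  rw [Finset.cast_card_sdiff hsub, ← hcount_eq_card htop, ← hcount_eq_card htop] at hle
  rw [BN, hsum, one_sub_div hpos.ne', div_eq_inv_mul]
  gcongr

/-- A finite weak `L¹` norm of the maximal function bounds the number of unit intervals on which it
is large. -/
theorem weak_bound_of_wnormE_ne_top {G : ℝ → ℝ≥0∞} (hG : wnormE volume 1 G ≠ ⊤) {l : ℝ} (hl : 0 < l)
    (S : Finset ℕ)
    (hS : ∀ m ∈ S, ∀ y ∈ Set.Ico ((m : ℝ) + 1) (m + 2), ENNReal.ofReal l ≤ G y) :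
    l * (S.card : ℝ) ≤ (wnormE volume 1 G).toReal := by
  have hvol : (S.card : ℝ≥0∞) ≤ volume {x | ENNReal.ofReal l ≤ G x} := by
    have hdisj : Set.PairwiseDisjoint (S : Set ℕ)
        fun m : ℕ => Set.Ico ((m : ℝ) + 1) (m + 2) := by
      intro a _ b _ hab
      rw [Function.onFun, Set.disjoint_left]
      rintro x ⟨h1, h2⟩ ⟨h3, h4⟩
      have h5 : (a : ℝ) < b + 1 := by linarith
      have h6 : (b : ℝ) < a + 1 := by linarith
      norm_cast at h5 h6
      omega
    calc (S.card : ℝ≥0∞) = ∑ m ∈ S, volume (Set.Ico ((m : ℝ) + 1) (m + 2)) := by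
          have h (m : ℕ) : (m : ℝ) + 2 - (m + 1) = 1 := by ring
          simp [Real.volume_Ico, h]
      _ = volume (⋃ m ∈ S, Set.Ico ((m : ℝ) + 1) (m + 2)) :=
          (measure_biUnion_finset hdisj fun _ _ => measurableSet_Ico).symm
      _ ≤ _ := measure_mono (Set.iUnion₂_subset fun m hm y hy => hS m hm y hy)
  have hle : ENNReal.ofReal l * (S.card : ℝ≥0∞) ≤ wnormE volume 1 G := by
    refine le_trans ?_ (le_iSup₂ (f := fun (y : ℝ) (_ : 0 < y) =>
      ENNReal.ofReal y * (volume {x | ENNReal.ofReal y ≤ G x}) ^ (1 / (1 : ℝ))) l hl)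
    rw [div_one, ENNReal.rpow_one]
    gcongr
  have h := ENNReal.toReal_mono hG hle
  rwa [ENNReal.toReal_mul, ENNReal.toReal_ofReal hl.le, ENNReal.toReal_natCast] at h

theorem half_le_one_sub_exp_neg {l : ℝ} (h0 : 0 ≤ l) (h1 : l ≤ 1) :
    l / 2 ≤ 1 - Real.exp (-l) := by
  have h := Real.add_one_le_exp l
  have : Real.exp (-l) ≤ (l + 1)⁻¹ := by
    rw [Real.exp_neg]
    exact inv_anti₀ (by linarith) h
  have h2 : (l + 1)⁻¹ ≤ 1 - l / 2 := by
    rw [inv_le_iff_one_le_mul₀ (by linarith)]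
    nlinarith
  linarith

/-- If the relative increments `1 - a m / a (m + 1)` of a positive monotone sequence are in
weak `ℓ¹`, then `log (a M)` grows at most logarithmically. -/
theorem exists_log_le_of_weak_bound {a : ℕ → ℝ} {m₀ : ℕ} {C : ℝ} (hC : 0 ≤ C)
    (hpos : ∀ m, m₀ ≤ m → 0 < a m)
    (hweak : ∀ l : ℝ, 0 < l → ∀ S : Finset ℕ,
      (∀ m ∈ S, m₀ ≤ m ∧ l ≤ 1 - a m / a (m + 1)) → l * (S.card : ℝ) ≤ C) :
    ∃ A : ℝ, ∀ M, m₀ < M → Real.log (a M) ≤ A + 2 * C * Real.log M := by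
  set e : ℕ → ℝ := fun m => Real.log (a (m + 1)) - Real.log (a m) with he
  have hstep : ∀ l : ℝ, ∀ m, m₀ ≤ m → 0 ≤ l → l ≤ 1 → l ≤ e m → l / 2 ≤ 1 - a m / a (m + 1) := by
    intro l m hm h0 h1 hle
    have hexp : a m / a (m + 1) = Real.exp (-e m) := by
      rw [he, neg_sub, Real.exp_sub, Real.exp_log (hpos _ hm), Real.exp_log (hpos _ (by omega))]
    have : Real.exp (-e m) ≤ Real.exp (-l) := Real.exp_le_exp.mpr (by linarith)
    rw [hexp]
    linarith [half_le_one_sub_exp_neg h0 h1]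
  have hfin : {m : ℕ | m₀ ≤ m ∧ 1 ≤ e m}.Finite := by
    by_contra hinf
    obtain ⟨K, hK⟩ := exists_nat_gt (2 * C)
    obtain ⟨S, hS, hcard⟩ := Set.Infinite.exists_subset_card_eq hinf K
    have h := hweak (1 / 2) (by norm_num) S fun m hm =>
      ⟨(hS hm).1, hstep 1 m (hS hm).1 zero_le_one le_rfl (hS hm).2⟩
    rw [hcard] at h
    linarith
  set L := hfin.toFinset
  refine ⟨Real.log (a m₀) + ∑ m ∈ L, |e m| + 2 * C, fun M hM => ?_⟩
  have htel : Real.log (a M) = Real.log (a m₀) + ∑ m ∈ Finset.Ico m₀ M, e m := by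
    rw [Finset.sum_Ico_sub (fun m => Real.log (a m)) hM.le]
    ring
  have hsplit : ∑ m ∈ Finset.Ico m₀ M, e m ≤
      ∑ m ∈ Finset.Ico m₀ M, min (e m) 1 + ∑ m ∈ L, |e m| := by
    have h1 : ∀ m ∈ Finset.Ico m₀ M, e m ≤ min (e m) 1 + if m ∈ L then |e m| else 0 := by
      intro m hm
      by_cases hmL : m ∈ L
      · have : 1 ≤ e m := (hfin.mem_toFinset.mp hmL).2
        rw [if_pos hmL, min_eq_right this]
        linarith [le_abs_self (e m)]
      · have : e m < 1 := by
          by_contra h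
          exact hmL (hfin.mem_toFinset.mpr ⟨(Finset.mem_Ico.mp hm).1, not_lt.mp h⟩)
        rw [if_neg hmL, min_eq_left this.le, add_zero]
    refine (Finset.sum_le_sum h1).trans ?_
    rw [Finset.sum_add_distrib, ← Finset.sum_filter]
    gcongr
    exact fun m hm => (Finset.mem_filter.mp hm).2
  have hharm := sum_le_mul_harmonic_of_weak_bound (fun m => min (e m) 1) (C := 2 * C)
    (by positivity) (Finset.Ico m₀ M) (fun l hl => by
      rcases le_or_gt l 1 with h1 | h1
      · have h := hweak (l / 2) (by positivity)
          ((Finset.Ico m₀ M).filter fun m => l ≤ min (e m) 1) fun m hm => by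
            rw [Finset.mem_filter, Finset.mem_Ico] at hm
            exact ⟨hm.1.1, hstep l m hm.1.1 hl.le h1 (hm.2.trans (min_le_left _ _))⟩
        linarith
      · rw [Finset.filter_false_of_mem fun m _ h => absurd (h.trans (min_le_right _ _))
          (not_le.mpr h1)]
        simpa using hC)
  have hlog : (harmonic (Finset.Ico m₀ M).card : ℝ) ≤ 1 + Real.log M := by
    rw [Nat.card_Ico]
    refine (harmonic_le_one_add_log _).trans ?_
    have h : (0 : ℝ) < ((M - m₀ : ℕ) : ℝ) := by exact_mod_cast Nat.sub_pos_of_lt hM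
    gcongr
    exact Nat.sub_le M m₀
  have := mul_le_mul_of_nonneg_left hlog (by positivity : 0 ≤ 2 * C)
  linarith

theorem wnormE_maximal_indicator_eq_top {t : ℕ → ℝ} (htop : Tendsto t atTop atTop)
    (hbig : ∀ k : ℕ, ∀ c : ℝ, ∃ᶠ N : ℕ in atTop, c * (N : ℝ) ^ k ≤ (hcount t N : ℝ)) :
    wnormE volume 1 (fun y => ⨆ (N : ℕ) (_ : 1 ≤ hcount t N),
        ENNReal.ofReal (BN t N ((Set.Ico (0 : ℝ) 2).indicator fun _ => (1 : ℝ)) y)) = ⊤ := by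
  by_contra hG
  obtain ⟨m₀, hm₀⟩ := (hbig 0 1).exists
  have hone : ∀ m, m₀ ≤ m → 1 ≤ hcount t m := fun m hm => by
    rw [pow_zero, mul_one] at hm₀
    exact (by exact_mod_cast hm₀ : 1 ≤ hcount t m₀).trans (hcount_mono htop hm)
  obtain ⟨A, hA⟩ := exists_log_le_of_weak_bound (a := fun m => (hcount t m : ℝ)) (m₀ := m₀)
    ENNReal.toReal_nonneg (fun m hm => by exact_mod_cast hone m hm)
    (fun l hl S hS => weak_bound_of_wnormE_ne_top hG hl S fun m hm y hy => by
      have h1 := hone (m + 1) ((hS m hm).1.trans m.le_succ)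
      exact (ENNReal.ofReal_le_ofReal ((hS m hm).2.trans (one_sub_div_le_BN htop m h1 hy))).trans
        (le_iSup₂ (f := fun (N : ℕ) (_ : 1 ≤ hcount t N) =>
          ENNReal.ofReal (BN t N ((Set.Ico (0 : ℝ) 2).indicator fun _ => (1 : ℝ)) y))
          (m + 1) h1))
  set C := (wnormE volume 1 (fun y => ⨆ (N : ℕ) (_ : 1 ≤ hcount t N),
    ENNReal.ofReal (BN t N ((Set.Ico (0 : ℝ) 2).indicator fun _ => (1 : ℝ)) y))).toReal
  obtain ⟨k, hk⟩ := exists_nat_ge (2 * C)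
  obtain ⟨M, hM, hMm⟩ := ((hbig k (Real.exp A + 1)).and_eventually
    (eventually_gt_atTop m₀)).exists
  have hMpos : (1 : ℝ) ≤ M := by exact_mod_cast (Nat.zero_le m₀).trans_lt hMm
  have hpos : (0 : ℝ) < hcount t M := by exact_mod_cast hone M hMm.le
  have hle : (hcount t M : ℝ) ≤ Real.exp A * (M : ℝ) ^ k := by
    rw [← Real.log_le_log_iff hpos (by positivity), Real.log_mul (Real.exp_pos A).ne'
      (by positivity), Real.log_exp, Real.log_pow]
    exact (hA M hMm).trans (by gcongr)
  have : (0 : ℝ) < (M : ℝ) ^ k := by positivity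
  linarith

theorem stmt16 (t : ℕ → ℝ) (hmono : ∀ n : ℕ, 1 ≤ n → t n < t (n + 1))
    (htop : Tendsto t atTop atTop)
    (hbig : ∀ k : ℕ, ∀ c : ℝ, ∃ᶠ N : ℕ in atTop,
      c * (N : ℝ) ^ k ≤ (hcount t N : ℝ)) :
    (¬ ∃ C : ℝ, 0 < C ∧ ∀ g : ℝ → ℝ, Integrable g volume →
      wnormE volume 1 (fun y => ⨆ (N : ℕ) (_ : 1 ≤ hcount t N),
          ENNReal.ofReal (BN t N g y))
        ≤ ENNReal.ofReal C * eLpNorm g 1 volume) ∧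
    wnormE volume 1 (fun y => ⨆ (N : ℕ) (_ : 1 ≤ hcount t N),
        ENNReal.ofReal (BN t N ((Set.Ico (0 : ℝ) 2).indicator fun _ => (1 : ℝ)) y))
      = ⊤ := by
  have htop_norm := wnormE_maximal_indicator_eq_top htop hbig
  refine ⟨?_, htop_norm⟩
  rintro ⟨C, -, hC⟩
  have hmem : MemLp ((Set.Ico (0 : ℝ) 2).indicator fun _ => (1 : ℝ)) 1 volume :=
    memLp_indicator_const 1 measurableSet_Ico 1 (Or.inr (by simp))
  have h := hC _ (memLp_one_iff_integrable.mp hmem)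
  rw [htop_norm] at h
  exact (ENNReal.mul_lt_top ENNReal.ofReal_lt_top hmem.eLpNorm_lt_top).not_ge h
end
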